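/- arXiv:0810.0062 — 4 statements merged into one kernel-verified Lean document; each statement's English description precedes it below -/
import Mathlib

section
/- Let g : ℂ → ℂ be an entire function and suppose there exist constants C > 0, N ∈ ℕ, and 0 ≤ τ < π such that |g(z)| ≤ C(1+|z|)^N e^{τ|Im z|} for all z ∈ ℂ. If g(k) = 0 for every nonnegative integer k, then g vanishes identically. -/
open Set Filter Asymptotics Complex in
/-- A holomorphic function on the right half-plane with `‖H z‖ ≤ A * exp (-δ * |Im z|)`, `δ > 0`,
vanishes on the positive real axis. -/
theorem eq_zero_of_norm_le_exp_neg_abs_im {H : ℂ → ℂ} {A δ : ℝ} (hδ : 0 < δ)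
    (hd : DifferentiableOn ℂ H {z | 0 < z.re})
    (hb : ∀ z : ℂ, 0 < z.re → ‖H z‖ ≤ A * Real.exp (-δ * |z.im|)) {x : ℝ} (hx : 0 < x) :
    H x = 0 := by
  have hA : 0 ≤ A := by simpa using (norm_nonneg _).trans (hb 1 (by simp))
  -- Phragmén–Lindelöf in the sector `|arg z| ≤ arctan (M / δ)`, in logarithmic coordinates
  have key : ∀ M : ℝ, 0 < M → ‖H x‖ ≤ A * Real.exp (-(M * x)) := by
    intro M hM
    set θ := Real.arctan (M / δ) with hθ
    have hθ0 : 0 < θ := Real.arctan_pos.2 (by positivity)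
    have hθ1 : θ < Real.pi / 2 := Real.arctan_lt_pi_div_two _
    have hcos : 0 < Real.cos θ := Real.cos_arctan_pos _
    have htan : δ * Real.sin θ = M * Real.cos θ := by
      have h := Real.tan_arctan (M / δ)
      rw [← hθ, Real.tan_eq_sin_div_cos] at h
      field_simp at h
      linarith
    have hre : ∀ ζ : ℂ, |ζ.im| ≤ θ → 0 < (exp ζ).re := fun ζ hζ ↦ by
      rw [exp_re]
      have := abs_le.1 hζ
      exact mul_pos (Real.exp_pos _) (Real.cos_pos_of_mem_Ioo ⟨by linarith, by linarith⟩)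
    set F : ℂ → ℂ := fun ζ ↦ H (exp ζ) * exp (M * exp ζ) with hF
    have hnorm : ∀ ζ : ℂ, |ζ.im| ≤ θ → ‖F ζ‖ ≤
        A * Real.exp (-δ * |(exp ζ).im| + M * (exp ζ).re) := fun ζ hζ ↦ by
      rw [hF, norm_mul, norm_exp, Real.exp_add, ← mul_assoc]
      have : ((M : ℂ) * exp ζ).re = M * (exp ζ).re := by simp
      rw [this]
      gcongr
      exact hb _ (hre ζ hζ)
    have hside : ∀ ζ : ℂ, |ζ.im| = θ → ‖F ζ‖ ≤ A := fun ζ hζ ↦ by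
      refine (hnorm ζ hζ.le).trans_eq ?_
      have hs : |Real.sin ζ.im| = Real.sin θ := by
        rw [← hζ, Real.abs_sin_eq_sin_abs_of_abs_le_pi (by linarith [Real.pi_pos])]
      have hc : Real.cos ζ.im = Real.cos θ := by rw [← hζ, Real.cos_abs]
      rw [exp_re, exp_im, abs_mul, hs, hc, abs_of_pos (Real.exp_pos _)]
      have : -δ * (Real.exp ζ.re * Real.sin θ) + M * (Real.exp ζ.re * Real.cos θ) = 0 := by
        linear_combination (-Real.exp ζ.re) * htan
      rw [this, Real.exp_zero, mul_one]
    have hdiff : DiffContOnCl ℂ F (im ⁻¹' Ioo (-θ) θ) := by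
      have : ∀ ζ : ℂ, |ζ.im| ≤ θ → DifferentiableAt ℂ F ζ := fun ζ hζ ↦ by
        have hH : DifferentiableAt ℂ H (exp ζ) :=
          hd.differentiableAt ((isOpen_lt continuous_const continuous_re).mem_nhds (hre ζ hζ))
        exact (hH.comp ζ differentiableAt_exp).mul (by fun_prop)
      refine DifferentiableOn.diffContOnCl fun ζ hζ ↦ (this ζ ?_).differentiableWithinAt
      have hcl : ζ ∈ im ⁻¹' Icc (-θ) θ :=
        closure_minimal (preimage_mono Ioo_subset_Icc_self)
          (isClosed_Icc.preimage continuous_im) hζ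
      exact abs_le.2 hcl
    have hgrowth : ∃ c < Real.pi / (θ - -θ), ∃ B,
        F =O[comap (_root_.abs ∘ re) atTop ⊓ 𝓟 (im ⁻¹' Ioo (-θ) θ)]
          fun z ↦ Real.exp (B * Real.exp (c * |z.re|)) := by
      refine ⟨1, ?_, M, IsBigO.of_bound A ?_⟩
      · rw [lt_div_iff₀ (by linarith)]; linarith
      · refine Filter.Eventually.filter_mono inf_le_right (eventually_principal.2 fun ζ hζ ↦ ?_)
        refine (hnorm ζ (abs_le.2 ⟨hζ.1.le, hζ.2.le⟩)).trans ?_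
        rw [Real.norm_eq_abs, Real.abs_exp]
        have h1 : (exp ζ).re ≤ Real.exp (1 * |ζ.re|) := by
          refine (re_le_norm _).trans ?_
          rw [norm_exp, one_mul]
          exact Real.exp_le_exp.2 (le_abs_self _)
        have h2 : 0 ≤ δ * |(exp ζ).im| := by positivity
        have h3 := mul_le_mul_of_nonneg_left h1 hM.le
        gcongr
        linarith
    have := PhragmenLindelof.horizontal_strip (z := (Real.log x : ℂ)) hdiff hgrowth
      (fun z hz ↦ hside z (by rw [hz, abs_neg, abs_of_pos hθ0]))
      (fun z hz ↦ hside z (by rw [hz, abs_of_pos hθ0])) (by simp [hθ0.le]) (by simp [hθ0.le])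
    rw [hF] at this
    simp only [← ofReal_exp, Real.exp_log hx, norm_mul] at this
    rw [← ofReal_mul, ← ofReal_exp, norm_real, Real.norm_eq_abs, Real.abs_exp] at this
    rwa [Real.exp_neg, ← div_eq_mul_inv, le_div_iff₀ (Real.exp_pos _)]
  have hlim : Tendsto (fun M : ℝ ↦ A * Real.exp (-(M * x))) atTop (nhds 0) := by
    simpa using (Real.tendsto_exp_neg_atTop_nhds_zero.comp
      (tendsto_id.atTop_mul_const hx)).const_mul A
  exact norm_le_zero_iff.1 (ge_of_tendsto hlim ((eventually_gt_atTop 0).mono key))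

theorem Complex.norm_sin_sq_eq (z : ℂ) :
    ‖Complex.sin z‖ ^ 2 = Real.sin z.re ^ 2 + Real.sinh z.im ^ 2 := by
  rw [← Complex.normSq_eq_norm_sq, Complex.sin_eq, Complex.normSq_apply]
  simp only [← Complex.ofReal_sin, ← Complex.ofReal_cos, ← Complex.ofReal_sinh,
    ← Complex.ofReal_cosh, Complex.add_re, Complex.add_im, Complex.mul_re, Complex.mul_im,
    Complex.ofReal_re, Complex.ofReal_im, Complex.I_re, Complex.I_im]
  have h1 := Real.sin_sq_add_cos_sq z.re
  have h2 := Real.cosh_sq z.im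
  linear_combination Real.sin z.re ^ 2 * h2 + Real.sinh z.im ^ 2 * h1

/-- In the strip `|Re w| ≤ 1 / 2`, `sin (π w)` is at least `2 ‖w‖` in norm. -/
theorem Complex.two_mul_norm_le_norm_sin_pi_mul {w : ℂ} (hw : |w.re| ≤ 1 / 2) :
    2 * ‖w‖ ≤ ‖Complex.sin (Real.pi * w)‖ := by
  have hpi := Real.pi_gt_three
  refine le_of_sq_le_sq ?_ (norm_nonneg _)
  rw [Complex.norm_sin_sq_eq, mul_pow, ← Complex.normSq_eq_norm_sq, Complex.normSq_apply]
  simp only [Complex.re_ofReal_mul, Complex.im_ofReal_mul]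
  have h1 : (2 * |w.re|) ^ 2 ≤ Real.sin (Real.pi * w.re) ^ 2 := by
    rw [← sq_abs (Real.sin _), Real.abs_sin_eq_sin_abs_of_abs_le_pi
      (by rw [abs_mul, abs_of_pos Real.pi_pos]; nlinarith)]
    have := Real.mul_le_sin (x := |Real.pi * w.re|) (abs_nonneg _)
      (by rw [abs_mul, abs_of_pos Real.pi_pos]; nlinarith)
    have e : 2 / Real.pi * |Real.pi * w.re| = 2 * |w.re| := by
      rw [abs_mul, abs_of_pos Real.pi_pos]; field_simp
    rw [e] at this
    gcongr
  have h2 : (Real.pi * |w.im|) ^ 2 ≤ Real.sinh (Real.pi * w.im) ^ 2 := by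
    rw [← sq_abs (Real.sinh _), Real.abs_sinh]
    have := Real.self_le_sinh_iff.2 (abs_nonneg (Real.pi * w.im))
    rw [abs_mul, abs_of_pos Real.pi_pos] at this ⊢
    gcongr
  rw [mul_pow, sq_abs] at h1 h2
  have h3 : 2 ^ 2 * w.im ^ 2 ≤ Real.pi ^ 2 * w.im ^ 2 := by gcongr; linarith
  linarith

/-- Away from the zeros, `sin (π w)` grows like `exp (π |Im w|)`. -/
theorem Complex.exp_pi_mul_abs_im_le {w : ℂ} (hw : |w.re| ≤ 1 / 2) (hw' : 1 / 2 ≤ ‖w‖) :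
    Real.exp (Real.pi * |w.im|) ≤ 3 * ‖Complex.sin (Real.pi * w)‖ := by
  have h1 := Complex.two_mul_norm_le_norm_sin_pi_mul hw
  have h2 : Real.sinh (Real.pi * |w.im|) ≤ ‖Complex.sin (Real.pi * w)‖ := by
    refine le_of_sq_le_sq ?_ (norm_nonneg _)
    rw [Complex.norm_sin_sq_eq]
    simp only [Complex.re_ofReal_mul, Complex.im_ofReal_mul]
    have : Real.sinh (Real.pi * |w.im|) = |Real.sinh (Real.pi * w.im)| := by
      rw [Real.abs_sinh, abs_mul, abs_of_pos Real.pi_pos]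
    rw [this, sq_abs]
    nlinarith [sq_nonneg (Real.sin (Real.pi * w.re))]
  have h3 : Real.exp (-(Real.pi * |w.im|)) ≤ 1 :=
    Real.exp_le_one_iff.2 (neg_nonpos.2 (by positivity))
  rw [Real.sinh_eq] at h2
  linarith

theorem Complex.norm_sin_pi_mul_sub_natCast (z : ℂ) (k : ℕ) :
    ‖Complex.sin (Real.pi * (z - k))‖ = ‖Complex.sin (Real.pi * z)‖ := by
  rw [mul_sub, mul_comm (Real.pi : ℂ) k, Complex.sin_antiperiodic.sub_nat_mul_eq]
  simp

/-- The quotient `g z / sin (π z)`, with the removable singularities filled in where `g`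
vanishes at an integer. -/
noncomputable def divSinPi (g : ℂ → ℂ) (z : ℂ) : ℂ :=
  if Complex.sin (Real.pi * z) = 0 then deriv g z / (Real.pi * Complex.cos (Real.pi * z))
  else g z / Complex.sin (Real.pi * z)

theorem sin_pi_mul_natCast (k : ℕ) : Complex.sin (Real.pi * (k : ℂ)) = 0 := by
  rw [mul_comm, Complex.sin_nat_mul_pi]

theorem sin_pi_mul_ne_zero_of_ne_natCast {z : ℂ} {k : ℕ} (hz : |(z - k).re| ≤ 1 / 2) (hne : z ≠ k) :
    Complex.sin (Real.pi * z) ≠ 0 := by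
  have h1 := Complex.two_mul_norm_le_norm_sin_pi_mul hz
  rw [Complex.norm_sin_pi_mul_sub_natCast] at h1
  have h2 := norm_pos_iff.2 (sub_ne_zero.2 hne)
  exact norm_pos_iff.1 (by linarith)

theorem hasDerivAt_sin_pi_mul (z : ℂ) :
    HasDerivAt (fun z : ℂ ↦ Complex.sin (Real.pi * z)) (Real.pi * Complex.cos (Real.pi * z)) z := by
  simpa [mul_comm] using ((hasDerivAt_id z).const_mul (Real.pi : ℂ)).csin

theorem differentiableAt_divSinPi {g : ℂ → ℂ} (hg : Differentiable ℂ g) {k : ℕ} (hk : g k = 0)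
    {z : ℂ} (hz : |(z - k).re| ≤ 1 / 2) : DifferentiableAt ℂ (divSinPi g) z := by
  set s : ℂ → ℂ := fun z ↦ Complex.sin (Real.pi * z) with hs
  have hsd : Differentiable ℂ s := fun z ↦ (hasDerivAt_sin_pi_mul z).differentiableAt
  by_cases hzk : z = k
  · subst hzk
    have hd : ∀ {f : ℂ → ℂ}, Differentiable ℂ f → DifferentiableAt ℂ (dslope f k) k := fun hf ↦
      ((Complex.differentiableOn_dslope (Filter.univ_mem)).2 hf.differentiableOn).differentiableAt
        Filter.univ_mem
    have hcos : Complex.cos (Real.pi * (k : ℂ)) ≠ 0 := fun h ↦ by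
      have := Complex.sin_sq_add_cos_sq (Real.pi * (k : ℂ))
      simp [h, sin_pi_mul_natCast] at this
    have hs0 : dslope s k k ≠ 0 := by
      rw [dslope_same, (hasDerivAt_sin_pi_mul _).deriv]
      exact mul_ne_zero (by exact_mod_cast Real.pi_ne_zero) hcos
    refine ((hd hg).div (hd hsd) hs0).congr_of_eventuallyEq ?_
    filter_upwards [Metric.ball_mem_nhds (k : ℂ) (by norm_num : (0 : ℝ) < 1 / 2)] with w hw
    have hw' : |(w - k).re| ≤ 1 / 2 :=
      (Complex.abs_re_le_norm _).trans (mem_ball_iff_norm.1 hw).le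
    rw [Pi.div_apply]
    by_cases hwk : w = k
    · subst hwk
      rw [divSinPi, if_pos (sin_pi_mul_natCast k), dslope_same, dslope_same,
        (hasDerivAt_sin_pi_mul _).deriv]
    · rw [divSinPi, if_neg (sin_pi_mul_ne_zero_of_ne_natCast hw' hwk), dslope_of_ne _ hwk, dslope_of_ne _ hwk,
        slope_def_field, slope_def_field, hk, hs]
      simp only [sin_pi_mul_natCast, sub_zero]
      rw [div_div_div_cancel_right₀ (sub_ne_zero.2 hwk)]
  · have hsz := sin_pi_mul_ne_zero_of_ne_natCast hz hzk
    refine ((hg z).div (hsd z) hsz).congr_of_eventuallyEq ?_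
    filter_upwards [(hsd z).continuousAt.eventually_ne hsz] with w hw
    rw [divSinPi, if_neg hw, Pi.div_apply]

theorem exists_natCast_abs_sub_re_le {z : ℂ} (hz : 0 < z.re) :
    ∃ k : ℕ, |(z - k).re| ≤ 1 / 2 := by
  refine ⟨(round z.re).toNat, ?_⟩
  have h0 : 0 ≤ round z.re := by
    rw [round_eq]; exact Int.floor_nonneg.2 (by linarith)
  have h1 : (((round z.re).toNat : ℕ) : ℝ) = round z.re := by
    exact_mod_cast congrArg (Int.cast : ℤ → ℝ) (Int.toNat_of_nonneg h0)
  rw [Complex.sub_re, Complex.natCast_re, h1]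
  exact abs_sub_round _

theorem norm_divSinPi_le_of_half_le {g : ℂ → ℂ} {C τ : ℝ} {N : ℕ}
    (hbound : ∀ z : ℂ, ‖g z‖ ≤ C * (1 + ‖z‖) ^ N * Real.exp (τ * |z.im|)) (hC : 0 < C) {k : ℕ}
    {z : ℂ} (hz : |(z - k).re| ≤ 1 / 2) (hz' : 1 / 2 ≤ ‖z - k‖) :
    ‖divSinPi g z‖ ≤ 3 * C * (1 + ‖z‖) ^ N * Real.exp (-(Real.pi - τ) * |z.im|) := by
  have hne : z ≠ k := fun h ↦ by rw [h, sub_self, norm_zero] at hz'; norm_num at hz'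
  have hs := sin_pi_mul_ne_zero_of_ne_natCast hz hne
  have h1 := Complex.exp_pi_mul_abs_im_le hz hz'
  rw [Complex.norm_sin_pi_mul_sub_natCast, Complex.sub_im, Complex.natCast_im, sub_zero] at h1
  rw [divSinPi, if_neg hs, norm_div, div_le_iff₀ (norm_pos_iff.2 hs)]
  refine (hbound z).trans ?_
  have e : Real.exp (τ * |z.im|) =
      Real.exp (-(Real.pi - τ) * |z.im|) * Real.exp (Real.pi * |z.im|) := by
    rw [← Real.exp_add]; ring_nf
  rw [e]
  have h2 := mul_le_mul_of_nonneg_left h1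
    (by positivity : 0 ≤ C * (1 + ‖z‖) ^ N * Real.exp (-(Real.pi - τ) * |z.im|))
  linarith

theorem norm_divSinPi_le {g : ℂ → ℂ} (hg : Differentiable ℂ g) {C τ : ℝ} {N : ℕ}
    (hbound : ∀ z : ℂ, ‖g z‖ ≤ C * (1 + ‖z‖) ^ N * Real.exp (τ * |z.im|)) (hC : 0 < C)
    (hτ : τ < Real.pi) {k : ℕ} (hk : g k = 0) {z : ℂ} (hz : |(z - k).re| ≤ 1 / 2) :
    ‖divSinPi g z‖ ≤ 3 * C * Real.exp ((Real.pi - τ) / 2) * (2 + ‖z‖) ^ N *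
      Real.exp (-(Real.pi - τ) * |z.im|) := by
  have hδ : 0 < Real.pi - τ := sub_pos.2 hτ
  rcases le_total (1 / 2) ‖z - k‖ with h | h
  · refine (norm_divSinPi_le_of_half_le hbound hC hz h).trans ?_
    have : 1 ≤ Real.exp ((Real.pi - τ) / 2) := Real.one_le_exp (by positivity)
    have h3 := le_mul_of_one_le_right (by positivity : 0 ≤ 3 * C) this
    gcongr ?_ * (?_ + _) ^ N * _
    norm_num
  · have hball : ∀ w ∈ Metric.closedBall (k : ℂ) (1 / 2), |(w - k).re| ≤ 1 / 2 := fun w hw ↦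
      (Complex.abs_re_le_norm _).trans (mem_closedBall_iff_norm.1 hw)
    have hdiff : DiffContOnCl ℂ (divSinPi g) (Metric.ball (k : ℂ) (1 / 2)) := by
      refine DifferentiableOn.diffContOnCl fun w hw ↦
        (differentiableAt_divSinPi hg hk (hball w ?_)).differentiableWithinAt
      exact Metric.closure_ball_subset_closedBall hw
    have hmax : ‖divSinPi g z‖ ≤ 3 * C * (2 + ‖z‖) ^ N := by
      refine Complex.norm_le_of_forall_mem_frontier_norm_le Metric.isBounded_ball hdiff
        (fun w hw ↦ ?_) (z := z) ?_
      · rw [frontier_ball _ (by norm_num), mem_sphere_iff_norm] at hw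
        refine (norm_divSinPi_le_of_half_le hbound hC
          (hball w (mem_closedBall_iff_norm.2 hw.le)) hw.ge).trans ?_
        have h1 : ‖w‖ ≤ 1 + ‖z‖ := by
          have e : w = (w - k) - (z - k) + z := by ring
          have h2 : ‖w‖ ≤ ‖w - k‖ + ‖z - k‖ + ‖z‖ := by
            conv_lhs => rw [e]
            exact (norm_add_le _ _).trans (by gcongr; exact norm_sub_le _ _)
          linarith
        have h2 : Real.exp (-(Real.pi - τ) * |w.im|) ≤ 1 :=
          Real.exp_le_one_iff.2 (by nlinarith [abs_nonneg w.im])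
        calc 3 * C * (1 + ‖w‖) ^ N * Real.exp (-(Real.pi - τ) * |w.im|)
            ≤ 3 * C * (1 + ‖w‖) ^ N * 1 := by gcongr
          _ ≤ 3 * C * (2 + ‖z‖) ^ N := by
            rw [mul_one]; gcongr 3 * C * ?_ ^ N; linarith
      · rw [closure_ball _ (by norm_num)]
        exact mem_closedBall_iff_norm.2 h
    have him : |z.im| ≤ 1 / 2 := by
      simpa using (Complex.abs_im_le_norm (z - k)).trans h
    have h1 : 1 ≤ Real.exp ((Real.pi - τ) / 2) * Real.exp (-(Real.pi - τ) * |z.im|) := by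
      rw [← Real.exp_add]
      exact Real.one_le_exp (by nlinarith)
    have h2 := mul_le_mul_of_nonneg_left h1 (by positivity : 0 ≤ 3 * C * (2 + ‖z‖) ^ N)
    linarith

/-- Carlson-type uniqueness theorem: an entire function of polynomial growth on the
real axis and exponential type `τ < π` in the imaginary direction that vanishes on the
nonnegative integers is identically zero. -/
theorem stmt_1 (g : ℂ → ℂ) (hg : Differentiable ℂ g)
    (C : ℝ) (hC : 0 < C) (N : ℕ) (τ : ℝ) (hτ0 : 0 ≤ τ) (hτπ : τ < Real.pi)
    (hbound : ∀ z : ℂ, ‖g z‖ ≤ C * (1 + ‖z‖) ^ N * Real.exp (τ * |z.im|))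
    (hzero : ∀ k : ℕ, g k = 0) :
    ∀ z : ℂ, g z = 0 := by
  have hne : ∀ z : ℂ, 0 < z.re → 2 + z ≠ 0 := fun z hz h ↦ by
    have := congrArg Complex.re h
    simp at this
    linarith
  have hpos : ∀ x : ℝ, 0 < x → g x = 0 := by
    intro x hx
    have hH := eq_zero_of_norm_le_exp_neg_abs_im (H := fun z ↦ divSinPi g z / (2 + z) ^ N)
      (A := 3 * C * Real.exp ((Real.pi - τ) / 2) * 2 ^ N) (sub_pos.2 hτπ) ?_ ?_ hx
    · obtain ⟨k, hk⟩ := exists_natCast_abs_sub_re_le (z := x) (by simpa using hx)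
      by_cases hxk : (x : ℂ) = k
      · rw [hxk, hzero]
      · have hs := sin_pi_mul_ne_zero_of_ne_natCast hk hxk
        have h2 := pow_ne_zero N (hne x (by simpa using hx))
        rw [divSinPi, if_neg hs] at hH
        simpa [hs, h2] using hH
    · intro z hz
      obtain ⟨k, hk⟩ := exists_natCast_abs_sub_re_le hz
      have hp : DifferentiableAt ℂ (fun z : ℂ ↦ (2 + z) ^ N) z := by fun_prop
      exact ((differentiableAt_divSinPi hg (hzero k) hk).div hp
        (pow_ne_zero N (hne z hz))).differentiableWithinAt
    · intro z hz
      obtain ⟨k, hk⟩ := exists_natCast_abs_sub_re_le hz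
      rw [norm_div, norm_pow, div_le_iff₀ (pow_pos (norm_pos_iff.2 (hne z hz)) N)]
      refine (norm_divSinPi_le hg hbound hC hτπ (hzero k) hk).trans ?_
      have h1 : 2 + ‖z‖ ≤ 2 * ‖2 + z‖ := by
        have h3 : 2 ≤ ‖2 + z‖ := by
          refine le_trans ?_ (Complex.re_le_norm _)
          simpa using hz.le
        have h4 : ‖z‖ ≤ ‖2 + z‖ := by
          refine le_of_sq_le_sq ?_ (norm_nonneg _)
          rw [← Complex.normSq_eq_norm_sq, ← Complex.normSq_eq_norm_sq, Complex.normSq_apply,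
            Complex.normSq_apply]
          simp
          nlinarith
        linarith
      have h2 : (2 + ‖z‖) ^ N ≤ 2 ^ N * ‖2 + z‖ ^ N := by
        rw [← mul_pow]; gcongr
      have h5 := mul_le_mul_of_nonneg_left h2 (by positivity :
        0 ≤ 3 * C * Real.exp ((Real.pi - τ) / 2) * Real.exp (-(Real.pi - τ) * |z.im|))
      linarith
  have hfreq : ∃ᶠ w in nhdsWithin (1 : ℂ) {1}ᶜ, g w = 0 := by
    have ht : Filter.Tendsto (fun x : ℝ ↦ (x : ℂ)) (nhdsWithin 1 {1}ᶜ)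
        (nhdsWithin (1 : ℂ) {1}ᶜ) := by
      refine tendsto_nhdsWithin_iff.2 ⟨?_, ?_⟩
      · exact (Complex.continuous_ofReal.tendsto' 1 1 (by simp)).mono_left nhdsWithin_le_nhds
      · filter_upwards [self_mem_nhdsWithin] with x hx
        simpa using hx
    refine ht.frequently (Filter.Eventually.frequently ?_)
    filter_upwards [nhdsWithin_le_nhds (lt_mem_nhds (zero_lt_one' ℝ))] with x hx
    exact hpos x hx
  have hg' : AnalyticOnNhd ℂ g Set.univ := hg.differentiableOn.analyticOnNhd isOpen_univ
  exact fun z ↦ hg'.eqOn_zero_of_preconnected_of_frequently_eq_zero isPreconnected_univ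
    (Set.mem_univ 1) hfreq (Set.mem_univ z)
end

section
/- Let Ω ⊆ ℝⁿ be open, let u : Ω → ℝ be infinitely differentiable, let K ⊆ Ω be compact, and let m ∈ ℕ. Then there exists a constant C' > 0 such that for every δ ∈ (0, 1] and every infinitely differentiable function h : ℝ → ℝ satisfying sup_{t∈ℝ} |h^{(i)}(t)| ≤ δ^{−i} for all i = 0, 1, …, m, one has ‖(iterated Fréchet derivative of order j of h∘u at x)‖ ≤ C'·δ^{−j} for every x ∈ K and every j = 0, 1, …, m. -/
open scoped Nat

/-- The iterated derivatives up to order `m` of a smooth function on an open set are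
uniformly bounded on a compact subset. -/
theorem ContDiffOn.exists_bound_iteratedFDerivWithin {E F : Type*} [NormedAddCommGroup E]
    [NormedSpace ℝ E] [NormedAddCommGroup F] [NormedSpace ℝ F] {s K : Set E} {f : E → F} {m : ℕ}
    (hf : ContDiffOn ℝ m f s) (hs : UniqueDiffOn ℝ s) (hK : IsCompact K) (hKs : K ⊆ s) :
    ∃ B : ℝ, 1 ≤ B ∧ ∀ i ≤ m, ∀ x ∈ K, ‖iteratedFDerivWithin ℝ i f s x‖ ≤ B := by
  have key : ∀ i, ∃ B : ℝ, i ≤ m → ∀ x ∈ K, ‖iteratedFDerivWithin ℝ i f s x‖ ≤ B := by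
    intro i
    by_cases hi : i ≤ m
    · obtain ⟨B, hB⟩ := hK.exists_bound_of_continuousOn
        ((hf.continuousOn_iteratedFDerivWithin (by exact_mod_cast hi) hs).mono hKs)
      exact ⟨B, fun _ => hB⟩
    · exact ⟨0, fun h => absurd h hi⟩
  choose b hb using key
  have hsum : 0 ≤ ∑ i ∈ Finset.range (m + 1), |b i| := by positivity
  refine ⟨1 + ∑ i ∈ Finset.range (m + 1), |b i|, by linarith, fun i hi x hx => ?_⟩
  have hle : |b i| ≤ ∑ i ∈ Finset.range (m + 1), |b i| :=
    Finset.single_le_sum (f := fun i => |b i|) (fun _ _ => abs_nonneg _)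
      (Finset.mem_range.2 (Nat.lt_succ_of_le hi))
  linarith [hb i hi x hx, le_abs_self (b i)]

/-- Faà di Bruno-type scaling estimate: if `u` is smooth on an open set `Ω ⊆ ℝⁿ`,
`K ⊆ Ω` is compact, and `h : ℝ → ℝ` satisfies `|h^{(i)}| ≤ δ^{−i}` for `i ≤ m`, then
the iterated derivatives of `h ∘ u` of order `j ≤ m` on `K` are bounded by `C' δ^{−j}`,
with `C'` independent of `δ` and `h`. -/
theorem stmt_7 (n : ℕ) (Ω : Set (Fin n → ℝ)) (hΩ : IsOpen Ω)
    (u : (Fin n → ℝ) → ℝ) (hu : ContDiffOn ℝ (⊤ : ℕ∞) u Ω)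
    (K : Set (Fin n → ℝ)) (hK : IsCompact K) (hKΩ : K ⊆ Ω) (m : ℕ) :
    ∃ C' : ℝ, 0 < C' ∧
      ∀ δ : ℝ, 0 < δ → δ ≤ 1 →
        ∀ h : ℝ → ℝ, ContDiff ℝ (⊤ : ℕ∞) h →
          (∀ i : ℕ, i ≤ m → ∀ t : ℝ, |iteratedDeriv i h t| ≤ 1 / δ ^ i) →
          ∀ x ∈ K, ∀ j : ℕ, j ≤ m →
            ‖iteratedFDerivWithin ℝ j (h ∘ u) Ω x‖ ≤ C' / δ ^ j := by
  obtain ⟨B, hB1, hB⟩ := (hu.of_le (m := (m : ℕ∞)) (by exact_mod_cast le_top)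
    ).exists_bound_iteratedFDerivWithin hΩ.uniqueDiffOn hK hKΩ
  refine ⟨m ! * B ^ m, by positivity, fun δ hδ hδ1 h hh hbound x hx j hj => ?_⟩
  have hcomp : ‖iteratedFDerivWithin ℝ j (h ∘ u) Ω x‖ ≤ j ! * (1 / δ ^ j) * B ^ j := by
    refine norm_iteratedFDerivWithin_comp_le hh.contDiffOn hu (by exact_mod_cast le_top)
      uniqueDiffOn_univ hΩ.uniqueDiffOn (Set.mapsTo_univ u Ω) (hKΩ hx)
      (fun i hi => ?_) (fun i hi1 hi => ?_)
    · rw [iteratedFDerivWithin_univ, norm_iteratedFDeriv_eq_norm_iteratedDeriv, Real.norm_eq_abs]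
      exact (hbound i (hi.trans hj) (u x)).trans
        (one_div_le_one_div_of_le (pow_pos hδ j) (pow_le_pow_of_le_one hδ.le hδ1 hi))
    · exact (hB i (hi.trans hj) x hx).trans (le_self_pow₀ hB1 (by omega))
  calc ‖iteratedFDerivWithin ℝ j (h ∘ u) Ω x‖ ≤ j ! * (1 / δ ^ j) * B ^ j := hcomp
    _ = j ! * B ^ j / δ ^ j := by ring
    _ ≤ m ! * B ^ m / δ ^ j := by gcongr
end

section
/- Let ℓ ≥ 1, let Ω ⊆ ℂ^ℓ be open, let X be a compact topological space, and let f : Ω × X → ℂ be continuous. Assume that for each fixed x ∈ X the map z ↦ f(z, x) is holomorphic on Ω (complex differentiable as a function of the ℓ complex variables). Then the curried map z ↦ f(z, ·), from Ω into the Banach space C(X, ℂ) of continuous complex-valued functions on X with the supremum norm, is holomorphic on Ω (differentiable over ℂ). -/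
open Metric Set Filter Topology in
/-- Second-order Taylor estimate for a holomorphic map sending a ball into a ball. -/
theorem norm_sub_sub_fderiv_le_of_mapsTo_ball
    {E G : Type*} [NormedAddCommGroup E] [NormedSpace ℂ E]
    [NormedAddCommGroup G] [NormedSpace ℂ G] {g : E → G} {c z : E} {R M : ℝ}
    (hd : DifferentiableOn ℂ g (ball c R)) (h_maps : MapsTo g (ball c R) (closedBall (g c) M))
    (hz : z ∈ ball c R) :
    ‖g z - g c - fderiv ℂ g c (z - c)‖ ≤ 2 * M * (‖z - c‖ / R) ^ 2 := by
  have hR : 0 < R := nonempty_ball.mp ⟨z, hz⟩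
  have hM : 0 ≤ M := nonempty_closedBall.mp ⟨_, h_maps hz⟩
  have hgc : DifferentiableAt ℂ g c := hd.differentiableAt (ball_mem_nhds c hR)
  have key := Complex.dist_le_mul_div_pow_of_mapsTo_ball_of_isLittleO
    (f := fun y => g y - g c - fderiv ℂ g c (y - c)) (c := c) (z := z) (R₁ := R)
    (R₂ := 2 * M) (n := 1) ?_ ?_ ?_ hz
  · simpa [dist_eq_norm_sub] using key
  · exact (hd.sub_const _).sub (by fun_prop)
  · intro y hy
    have h₁ : ‖g y - g c‖ ≤ M := by simpa [dist_eq_norm_sub] using h_maps hy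
    have h₂ : ‖fderiv ℂ g c (y - c)‖ ≤ M := by
      have hy' : ‖y - c‖ ≤ R := (mem_ball_iff_norm.mp hy).le
      calc ‖fderiv ℂ g c (y - c)‖ ≤ M / R * R :=
            (fderiv ℂ g c).le_of_opNorm_le_of_le
              (Complex.norm_fderiv_le_div_of_mapsTo_ball hd h_maps hR) hy'
        _ = M := div_mul_cancel₀ M hR.ne'
    simpa [two_mul] using (norm_sub_le _ _).trans (add_le_add h₁ h₂)
  · simpa using hgc.hasFDerivAt.isLittleO.norm_right

open Metric Set Filter Topology in
/-- A map into a space of continuous functions on a compact space is complex differentiable at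
a point if it is continuous there and pointwise holomorphic near that point. -/
theorem ContinuousMap.differentiableAt_of_eventually_differentiableAt_eval
    {E G X : Type*} [NormedAddCommGroup E] [NormedSpace ℂ E]
    [NormedAddCommGroup G] [NormedSpace ℂ G] [TopologicalSpace X] [CompactSpace X]
    {F : E → C(X, G)} {c : E} (hc : ContinuousAt F c)
    (hd : ∀ᶠ z in 𝓝 c, ∀ x, DifferentiableAt ℂ (fun y => F y x) z) :
    DifferentiableAt ℂ F c := by
  obtain ⟨R, hR, hball⟩ := Metric.eventually_nhds_iff_ball.mp
    (hd.and (hc.eventually (closedBall_mem_nhds (F c) one_pos)))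
  have hdiff (x : X) : DifferentiableOn ℂ (fun y => F y x) (ball c R) := fun z hz =>
    ((hball z hz).1 x).differentiableWithinAt
  have hmaps (x : X) : MapsTo (fun y => F y x) (ball c R) (closedBall (F c x) 1) := fun z hz =>
    (ContinuousMap.dist_apply_le_dist x).trans (hball z hz).2
  have taylor (x : X) {z : E} (hz : z ∈ ball c R) :=
    norm_sub_sub_fderiv_le_of_mapsTo_ball (hdiff x) (hmaps x) hz
  have hcont (w : E) : Continuous fun x => fderiv ℂ (fun y => F y x) c w := by
    have hlim : TendstoUniformly (fun (t : ℂ) x => t⁻¹ • (F (c + t • w) x - F c x))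
        (fun x => fderiv ℂ (fun y => F y x) c w) (𝓝[≠] 0) := by
      rw [Metric.tendstoUniformly_iff]
      intro ε hε
      have hsmall : ∀ᶠ t : ℂ in 𝓝 0, 2 * ‖t‖ * (‖w‖ / R) ^ 2 < ε :=
        ContinuousAt.eventually_lt (by fun_prop) continuousAt_const (by simpa using hε)
      have hmem : ∀ᶠ t : ℂ in 𝓝 0, c + t • w ∈ ball c R :=
        ContinuousAt.eventually_mem (by fun_prop) (by simpa using ball_mem_nhds c hR)
      filter_upwards [nhdsWithin_le_nhds hsmall, nhdsWithin_le_nhds hmem, self_mem_nhdsWithin]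
        with t ht htR ht0 x
      have ht0 : t ≠ 0 := ht0
      have hest := taylor x htR
      rw [add_sub_cancel_left, map_smul] at hest
      refine lt_of_le_of_lt ?_ ht
      have heq : t⁻¹ • (F (c + t • w) x - F c x) - fderiv ℂ (fun y => F y x) c w =
          t⁻¹ • (F (c + t • w) x - F c x - t • fderiv ℂ (fun y => F y x) c w) := by
        rw [smul_sub t⁻¹ _ (t • _), smul_smul, inv_mul_cancel₀ ht0, one_smul]
      rw [dist_comm, dist_eq_norm_sub, heq, norm_smul, norm_inv,
        inv_mul_le_iff₀ (norm_pos_iff.mpr ht0)]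
      refine hest.trans_eq ?_
      rw [norm_smul]
      ring
    exact hlim.continuous (Eventually.frequently (Eventually.of_forall fun t => by fun_prop))
  let L : E →L[ℂ] C(X, G) := LinearMap.mkContinuous
    { toFun := fun w => ⟨_, hcont w⟩
      map_add' := fun v w => by ext x; simp
      map_smul' := fun a w => by ext x; simp } (1 / R) fun w => by
        refine (ContinuousMap.norm_le _ (by positivity)).mpr fun x => ?_
        exact (fderiv ℂ (fun y => F y x) c).le_of_opNorm_le
          (Complex.norm_fderiv_le_div_of_mapsTo_ball (hdiff x) (hmaps x) hR) w
  have hL : HasFDerivAt F L c := by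
    refine .of_isLittleO <| Asymptotics.IsBigO.trans_isLittleO
      (g := fun z => ‖z - c‖ ^ 2) ?_ ?_
    · refine Asymptotics.IsBigO.of_bound (2 / R ^ 2) ?_
      filter_upwards [ball_mem_nhds c hR] with z hz
      refine (ContinuousMap.norm_le _ (by positivity)).mpr fun x => (taylor x hz).trans_eq ?_
      rw [norm_pow, norm_norm]
      ring
    · exact Asymptotics.isLittleO_pow_sub_sub c one_lt_two
  exact hL.differentiableAt


/-- Strong holomorphy of parametrized families: if `f : Ω × X → ℂ` is continuous on
`Ω × X` (with `Ω ⊆ ℂ^ℓ` open and `X` compact) and holomorphic in the first variable for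
each fixed `x ∈ X`, then the curried map `z ↦ f(z, ·)` is holomorphic from `Ω` into the
Banach space `C(X, ℂ)` with the supremum norm. -/
theorem stmt_8 (ℓ : ℕ) (hℓ : 1 ≤ ℓ) (Ω : Set (Fin ℓ → ℂ)) (hΩ : IsOpen Ω)
    (X : Type*) [TopologicalSpace X] [CompactSpace X]
    (f : (Fin ℓ → ℂ) × X → ℂ)
    (hf : ContinuousOn f (Ω ×ˢ (Set.univ : Set X)))
    (hhol : ∀ x : X, DifferentiableOn ℂ (fun z => f (z, x)) Ω)
    (F : (Fin ℓ → ℂ) → C(X, ℂ))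
    (hF : ∀ z ∈ Ω, ∀ x : X, F z x = f (z, x)) :
    DifferentiableOn ℂ F Ω := by
  have hcont : ContinuousOn F Ω := by
    refine ContinuousMap.continuousOn_of_continuousOn_uncurry F (hf.congr ?_)
    rintro ⟨z, x⟩ hz
    exact hF z hz.1 x
  intro z hz
  refine (ContinuousMap.differentiableAt_of_eventually_differentiableAt_eval
    (hcont.continuousAt (hΩ.mem_nhds hz)) ?_).differentiableWithinAt
  filter_upwards [hΩ.mem_nhds hz] with w hw x
  exact ((hhol x).congr fun y hy => hF y hy x).differentiableAt (hΩ.mem_nhds hw)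
end

section
/- Let E be a complex Banach space, let Ω ⊆ ℂ be open, and let f : Ω → E be a function such that for every continuous linear functional φ : E → ℂ the composition φ ∘ f is holomorphic on Ω (complex differentiable at every point of Ω). Then f itself is holomorphic on Ω, i.e., f is differentiable over ℂ at every point of Ω. -/
/-- A family in a normed space that is weakly bounded is norm bounded. -/
theorem exists_norm_le_of_forall_dual_bounded {ι E : Type*} [NormedAddCommGroup E]
    [NormedSpace ℂ E] (x : ι → E) (h : ∀ φ : E →L[ℂ] ℂ, ∃ C, ∀ i, ‖φ (x i)‖ ≤ C) :
    ∃ C, ∀ i, ‖x i‖ ≤ C := by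
  obtain ⟨C, hC⟩ := banach_steinhaus
    (g := fun i => NormedSpace.inclusionInDoubleDual ℂ E (x i)) h
  refine ⟨C, fun i => ?_⟩
  rw [← (NormedSpace.inclusionInDoubleDualLi (E := E) ℂ).norm_map]
  exact hC i

/-- A function holomorphic on an open set is Lipschitz on each closed ball it contains. -/
theorem DifferentiableOn.exists_lipschitzOnWith_closedBall {g : ℂ → ℂ} {Ω : Set ℂ}
    (hΩ : IsOpen Ω) (hg : DifferentiableOn ℂ g Ω) {z : ℂ} {r : ℝ}
    (hr : Metric.closedBall z r ⊆ Ω) :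
    ∃ C, LipschitzOnWith C g (Metric.closedBall z r) := by
  obtain ⟨C, hC⟩ := (isCompact_closedBall z r).exists_bound_of_continuousOn
    ((hg.deriv hΩ).continuousOn.mono hr)
  refine ⟨C.toNNReal, (convex_closedBall z r).lipschitzOnWith_of_nnnorm_deriv_le
    (fun w hw => hg.differentiableAt (hΩ.mem_nhds (hr hw))) fun w hw => ?_⟩
  exact NNReal.le_toNNReal_of_coe_le (hC w hw)

/-- The slopes at `z` of a weakly holomorphic function are Lipschitz on a punctured closed ball
around `z`. -/
theorem exists_lipschitzOnWith_slope_of_weakly_holomorphic {E : Type*} [NormedAddCommGroup E]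
    [NormedSpace ℂ E] {Ω : Set ℂ} (hΩ : IsOpen Ω) {f : ℂ → E}
    (hweak : ∀ φ : E →L[ℂ] ℂ, ∀ z ∈ Ω, DifferentiableAt ℂ (fun w => φ (f w)) z)
    {z : ℂ} (hz : z ∈ Ω) {r : ℝ} (hr : Metric.closedBall z r ⊆ Ω) :
    ∃ C, LipschitzOnWith C (slope f z) (Metric.closedBall z r \ {z}) := by
  obtain ⟨C, hC⟩ := exists_norm_le_of_forall_dual_bounded
    (fun p : ↥(Metric.closedBall z r \ {z}) × ↥(Metric.closedBall z r \ {z}) =>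
      ((p.1 : ℂ) - p.2)⁻¹ • (slope f z p.1 - slope f z p.2)) (fun φ => by
    have hd : DifferentiableOn ℂ (dslope (fun w => φ (f w)) z) Ω :=
      (Complex.differentiableOn_dslope (hΩ.mem_nhds hz)).2
        fun w hw => (hweak φ w hw).differentiableWithinAt
    obtain ⟨C, hC⟩ := hd.exists_lipschitzOnWith_closedBall hΩ hr
    refine ⟨C, fun ⟨⟨u, hu⟩, ⟨v, hv⟩⟩ => ?_⟩
    have key : ∀ w ∈ Metric.closedBall z r \ {z},
        φ (slope f z w) = dslope (fun w => φ (f w)) z w := fun w hw => by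
      rw [dslope_of_ne _ hw.2]
      simp [slope_def_module]
    have h := hC.norm_sub_le hu.1 hv.1
    rw [← key u hu, ← key v hv] at h
    simp only [map_smul, map_sub, norm_smul, norm_inv]
    rw [inv_mul_eq_div]
    exact div_le_of_le_mul₀ (norm_nonneg _) C.2 h)
  refine ⟨C.toNNReal, LipschitzOnWith.of_dist_le_mul fun u hu v hv => ?_⟩
  rw [dist_eq_norm, dist_eq_norm]
  rcases eq_or_ne u v with rfl | huv
  · simp
  have h := hC (⟨u, hu⟩, ⟨v, hv⟩)
  rw [norm_smul, norm_inv, inv_mul_le_iff₀ (norm_pos_iff.2 (sub_ne_zero.2 huv)), mul_comm] at h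
  exact h.trans (mul_le_mul_of_nonneg_right (Real.le_coe_toNNReal C) (norm_nonneg _))

/-- Dunford's theorem: weak holomorphy implies strong holomorphy. If `f : Ω → E` maps an
open set `Ω ⊆ ℂ` into a complex Banach space and `φ ∘ f` is holomorphic on `Ω` for every
continuous linear functional `φ`, then `f` is holomorphic on `Ω`. -/
theorem stmt_9 (E : Type*) [NormedAddCommGroup E] [NormedSpace ℂ E] [CompleteSpace E]
    (Ω : Set ℂ) (hΩ : IsOpen Ω) (f : ℂ → E)
    (hweak : ∀ φ : E →L[ℂ] ℂ, ∀ z ∈ Ω, DifferentiableAt ℂ (fun w => φ (f w)) z) :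
    ∀ z ∈ Ω, DifferentiableAt ℂ f z := by
  intro z hz
  obtain ⟨r, hr, hball⟩ := Metric.nhds_basis_closedBall.mem_iff.1 (hΩ.mem_nhds hz)
  obtain ⟨C, hC⟩ := exists_lipschitzOnWith_slope_of_weakly_holomorphic hΩ hweak hz hball
  have hmem : Metric.closedBall z r \ {z} ∈ nhdsWithin z {z}ᶜ :=
    Filter.inter_mem (mem_nhdsWithin_of_mem_nhds (Metric.closedBall_mem_nhds z hr))
      self_mem_nhdsWithin
  have hcauchy : Cauchy (Filter.map (slope f z) (nhdsWithin z {z}ᶜ)) :=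
    (cauchy_nhds.mono nhdsWithin_le_nhds).map_of_le hC.uniformContinuousOn
      (Filter.le_principal_iff.2 hmem)
  obtain ⟨f', hf'⟩ := CompleteSpace.complete hcauchy
  exact (hasDerivAt_iff_tendsto_slope.2 hf').differentiableAt
end
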